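/- arXiv:2303.14629 — 4 statements merged into one kernel-verified Lean document; each statement's English description precedes it below -/
import Mathlib

section
/- Let 1 ≤ m ≤ n be integers. Then [∫_{[0,∞)^m} (Σ_{l=1}^m x_l ln x_l) · Π_{1≤j<k≤m}(x_k−x_j)² · Π_{j=1}^m x_j^{n−m} e^{−x_j} dx] / [∫_{[0,∞)^m} Π_{1≤j<k≤m}(x_k−x_j)² · Π_{j=1}^m x_j^{n−m} e^{−x_j} dx] = Σ_{k=0}^{m−1} [1 + 2k + (2k+n−m+1)·ψ(k+n−m+1)], where ψ(N+1) = −γ + H_N is the digamma function at positive integers, γ is the Euler–Mascheroni constant, and H_N = Σ_{r=1}^N 1/r. -/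
open MeasureTheory

noncomputable section

/-- The value `ψ(N+1)` of the digamma function at the positive integer `N+1`:
`ψ(N+1) = −γ + H_N` where `γ` is the Euler–Mascheroni constant and
`H_N = ∑_{r=1}^N 1/r`. -/
def digammaSucc (N : ℕ) : ℝ :=
  -Real.eulerMascheroniConstant + ∑ r ∈ Finset.Icc 1 N, (1 : ℝ) / r

section SquaredDeterminant

variable {E : Type*} {m : ℕ}

lemma det_sq_mul_prod_eq_sum (φ v : Fin m → E → ℝ) (x : Fin m → E) :
    (Matrix.of fun i j => φ j (x i)).det ^ 2 * ∏ i, v i (x i) =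
      ∑ σ : Equiv.Perm (Fin m), ∑ τ : Equiv.Perm (Fin m),
        ((σ.sign : ℤ) : ℝ) * ((τ.sign : ℤ) : ℝ) *
          ∏ i, (φ (σ i) (x i) * φ (τ i) (x i) * v i (x i)) := by
  rw [← Matrix.det_transpose, Matrix.det_apply', sq, Finset.sum_mul_sum, Finset.sum_mul]
  refine Finset.sum_congr rfl fun σ _ => ?_
  rw [Finset.sum_mul]
  refine Finset.sum_congr rfl fun τ _ => ?_
  simp only [Matrix.transpose_apply, Matrix.of_apply, Finset.prod_mul_distrib]
  ring

variable [MeasurableSpace E] {μ : Measure E} [SigmaFinite μ] {φ v : Fin m → E → ℝ}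

lemma integrable_det_sq_mul_prod
    (hint : ∀ a b i, Integrable (fun x => φ a x * φ b x * v i x) μ) :
    Integrable (fun x : Fin m → E => (Matrix.of fun i j => φ j (x i)).det ^ 2 * ∏ i, v i (x i))
      (Measure.pi fun _ => μ) := by
  simp_rw [det_sq_mul_prod_eq_sum]
  exact integrable_finsetSum _ fun σ _ => integrable_finsetSum _ fun τ _ =>
    (Integrable.fintype_prod fun i => hint (σ i) (τ i) i).const_mul _

/-- If the `φ a` are orthogonal for all the weights `v i` but possibly one, only the diagonal
terms in the expansion of the squared determinant contribute to its integral. -/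
lemma integral_det_sq_mul_prod (l : Fin m)
    (hint : ∀ a b i, Integrable (fun x => φ a x * φ b x * v i x) μ)
    (horth : ∀ a b i, a ≠ b → i ≠ l → ∫ x, φ a x * φ b x * v i x ∂μ = 0) :
    ∫ x : Fin m → E, (Matrix.of fun i j => φ j (x i)).det ^ 2 * ∏ i, v i (x i)
        ∂(Measure.pi fun _ => μ) =
      ∑ σ : Equiv.Perm (Fin m), ∏ i, ∫ x, φ (σ i) x * φ (σ i) x * v i x ∂μ := by
  simp_rw [det_sq_mul_prod_eq_sum]
  have hi (σ τ : Equiv.Perm (Fin m)) : Integrable (fun x : Fin m → E =>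
      ((σ.sign : ℤ) : ℝ) * ((τ.sign : ℤ) : ℝ) *
          ∏ i, (φ (σ i) (x i) * φ (τ i) (x i) * v i (x i))) (Measure.pi fun _ => μ) :=
    (Integrable.fintype_prod fun i => hint (σ i) (τ i) i).const_mul _
  rw [integral_finsetSum _ fun σ _ => integrable_finsetSum _ fun τ _ => hi σ τ]
  refine Finset.sum_congr rfl fun σ _ => ?_
  rw [integral_finsetSum _ fun τ _ => hi σ τ]
  simp_rw [integral_const_mul]
  have hprod (τ : Equiv.Perm (Fin m)) :
      ∫ x : Fin m → E, ∏ i, (φ (σ i) (x i) * φ (τ i) (x i) * v i (x i))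
        ∂(Measure.pi fun _ => μ) = ∏ i, ∫ x, φ (σ i) x * φ (τ i) x * v i x ∂μ :=
    integral_fintype_prod_eq_prod fun i x => φ (σ i) x * φ (τ i) x * v i x
  simp_rw [hprod]
  rw [Finset.sum_eq_single σ]
  · have : (((σ.sign : ℤ) : ℝ)) * ((σ.sign : ℤ) : ℝ) = 1 := by
      rw [← Int.cast_mul, Int.units_coe_mul_self, Int.cast_one]
    rw [this, one_mul]
  · intro τ _ hτ
    obtain ⟨i, hil, hi⟩ : ∃ i, i ≠ l ∧ σ i ≠ τ i := by
      by_contra! h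
      apply hτ
      have hinv : τ⁻¹ * σ = 1 := by
        ext i
        by_cases hi : i = l
        · subst hi
          by_contra hne
          have h1 : (τ⁻¹ * σ) i ≠ i := fun h' => hne (by simpa using congrArg Fin.val h')
          have h2 := h _ h1
          have h3 : σ ((τ⁻¹ * σ) i) = σ i := by rw [h2]; simp
          exact h1 (σ.injective h3)
        · simp [h i hi]
      exact (inv_mul_eq_one.mp hinv)
    rw [Finset.prod_eq_zero (Finset.mem_univ i) (horth _ _ i hi hil), mul_zero]
  · simp

variable {w f : E → ℝ}

/-- The mean of the linear statistic `∑ f (x l)` in an orthogonal polynomial ensemble. -/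
lemma integral_sum_mul_det_sq_div (hm : 0 < m)
    (hint : ∀ a b, Integrable (fun x => φ a x * φ b x * w x) μ)
    (hintf : ∀ a b, Integrable (fun x => φ a x * φ b x * (f x * w x)) μ)
    (horth : ∀ a b, a ≠ b → ∫ x, φ a x * φ b x * w x ∂μ = 0)
    (hne : ∀ a, ∫ x, φ a x * φ a x * w x ∂μ ≠ 0) :
    (∫ x : Fin m → E, (∑ l, f (x l)) *
        ((Matrix.of fun i j => φ j (x i)).det ^ 2 * ∏ i, w (x i)) ∂(Measure.pi fun _ => μ)) /
      (∫ x : Fin m → E, (Matrix.of fun i j => φ j (x i)).det ^ 2 * ∏ i, w (x i)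
        ∂(Measure.pi fun _ => μ)) =
      ∑ a, (∫ x, φ a x * φ a x * (f x * w x) ∂μ) / ∫ x, φ a x * φ a x * w x ∂μ := by
  set h : Fin m → ℝ := fun a => ∫ x, φ a x * φ a x * w x ∂μ
  set A : Fin m → ℝ := fun a => ∫ x, φ a x * φ a x * (f x * w x) ∂μ
  have hden : ∫ x : Fin m → E, (Matrix.of fun i j => φ j (x i)).det ^ 2 * ∏ i, w (x i)
        ∂(Measure.pi fun _ => μ) = (m.factorial : ℝ) * ∏ a, h a := by
    rw [integral_det_sq_mul_prod (v := fun _ => w) ⟨0, hm⟩ (fun a b _ => hint a b)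
      (fun a b _ hab _ => horth a b hab)]
    have (σ : Equiv.Perm (Fin m)) : ∏ i, h (σ i) = ∏ a, h a := Equiv.prod_comp σ h
    simp only [h] at this
    simp [this, Fintype.card_perm, h]
  let v (l i : Fin m) : E → ℝ := if i = l then fun x => f x * w x else w
  have hv (l : Fin m) (x : Fin m → E) : ∏ i, v l i (x i) = f (x l) * ∏ i, w (x i) := by
    rw [← Finset.mul_prod_erase _ _ (Finset.mem_univ l),
      ← Finset.mul_prod_erase _ (fun i => w (x i)) (Finset.mem_univ l), ← mul_assoc]
    congr 1
    · simp [v]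
    · refine Finset.prod_congr rfl fun i hi => ?_
      simp [v, Finset.ne_of_mem_erase hi]
  have hvi (l a b i : Fin m) : Integrable (fun x => φ a x * φ b x * v l i x) μ := by
    by_cases hi : i = l
    · simpa [v, hi] using hintf a b
    · simpa [v, hi] using hint a b
  have hnum : ∫ x : Fin m → E, (∑ l, f (x l)) *
        ((Matrix.of fun i j => φ j (x i)).det ^ 2 * ∏ i, w (x i)) ∂(Measure.pi fun _ => μ) =
      (m.factorial : ℝ) * (∏ a, h a) * ∑ a, A a / h a := by
    have hexp (x : Fin m → E) : (∑ l, f (x l)) *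
        ((Matrix.of fun i j => φ j (x i)).det ^ 2 * ∏ i, w (x i)) =
        ∑ l, (Matrix.of fun i j => φ j (x i)).det ^ 2 * ∏ i, v l i (x i) := by
      simp_rw [hv, Finset.sum_mul]
      exact Finset.sum_congr rfl fun l _ => by ring
    simp_rw [hexp]
    rw [integral_finsetSum _ fun l _ => integrable_det_sq_mul_prod (hvi l)]
    have hl (l : Fin m) : ∫ x : Fin m → E,
        (Matrix.of fun i j => φ j (x i)).det ^ 2 * ∏ i, v l i (x i) ∂(Measure.pi fun _ => μ) =
        ∑ σ : Equiv.Perm (Fin m), (∏ a, h a) * (A (σ l) / h (σ l)) := by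
      rw [integral_det_sq_mul_prod l (hvi l)]
      · refine Finset.sum_congr rfl fun σ _ => ?_
        rw [← Equiv.prod_comp σ h, ← Finset.mul_prod_erase _ _ (Finset.mem_univ l),
          ← Finset.mul_prod_erase _ (fun i => h (σ i)) (Finset.mem_univ l)]
        have h1 : ∏ i ∈ Finset.univ.erase l, ∫ x, φ (σ i) x * φ (σ i) x * v l i x ∂μ =
            ∏ i ∈ Finset.univ.erase l, h (σ i) := by
          refine Finset.prod_congr rfl fun i hi => ?_
          simp [v, Finset.ne_of_mem_erase hi, h]
        have h2 : ∫ x, φ (σ l) x * φ (σ l) x * v l l x ∂μ = A (σ l) := by simp [v, A]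
        have h3 : h (σ l) ≠ 0 := hne _
        rw [h1, h2]
        field_simp
      · intro a b i hab hi
        simpa [v, hi] using horth a b hab
    simp_rw [hl]
    rw [Finset.sum_comm]
    have hσ (σ : Equiv.Perm (Fin m)) :
        ∑ l, (∏ a, h a) * (A (σ l) / h (σ l)) = (∏ a, h a) * ∑ a, A a / h a := by
      rw [← Finset.mul_sum, Equiv.sum_comp σ fun a => A a / h a]
    simp only [hσ, Finset.sum_const, Finset.card_univ, Fintype.card_perm, Fintype.card_fin,
      nsmul_eq_mul, mul_assoc]
  have hD : (m.factorial : ℝ) * ∏ a, h a ≠ 0 :=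
    mul_ne_zero (by positivity) (Finset.prod_ne_zero_iff.mpr fun a _ => hne a)
  rw [hnum, hden, mul_div_cancel_left₀ _ hD]

end SquaredDeterminant

section Moments

lemma digammaSucc_succ (N : ℕ) : digammaSucc (N + 1) = digammaSucc N + 1 / ((N : ℝ) + 1) := by
  simp only [digammaSucc, Finset.sum_Icc_succ_top (Nat.le_add_left 1 N)]
  push_cast
  ring

lemma digammaSucc_eq_harmonic (N : ℕ) :
    digammaSucc N = -Real.eulerMascheroniConstant + harmonic N := by
  simp [digammaSucc, harmonic_eq_sum_Icc]

lemma integrableOn_pow_mul_exp_neg (k : ℕ) :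
    IntegrableOn (fun x : ℝ => x ^ k * Real.exp (-x)) (Set.Ici 0) := by
  rw [integrableOn_Ici_iff_integrableOn_Ioi]
  refine (Real.GammaIntegral_convergent (s := k + 1) (by positivity)).congr_fun (fun x _ => ?_)
    measurableSet_Ioi
  simp [mul_comm]

lemma integral_pow_mul_exp_neg (k : ℕ) :
    ∫ x in Set.Ici (0 : ℝ), x ^ k * Real.exp (-x) = (k.factorial : ℝ) := by
  rw [integral_Ici_eq_integral_Ioi, ← Real.Gamma_nat_eq_factorial,
    Real.Gamma_eq_integral (by positivity)]
  refine setIntegral_congr_fun measurableSet_Ioi fun x _ => ?_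
  simp [mul_comm]

lemma abs_mul_log_le {x : ℝ} (hx : 0 ≤ x) : |x * Real.log x| ≤ 1 + x ^ 2 := by
  rcases hx.eq_or_lt with rfl | hx
  · simp
  have h1 := Real.log_le_sub_one_of_pos hx
  have h2 := Real.one_sub_inv_le_log_of_pos hx
  have h3 : x * (1 - x⁻¹) = x - 1 := by field_simp
  have h4 := mul_le_mul_of_nonneg_left h1 hx.le
  have h5 := mul_le_mul_of_nonneg_left h2 hx.le
  rw [abs_le]
  constructor <;> nlinarith

lemma integrableOn_pow_mul_log_mul_exp_neg (k : ℕ) :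
    IntegrableOn (fun x : ℝ => x ^ k * (x * Real.log x * Real.exp (-x))) (Set.Ici 0) := by
  have hb := (integrableOn_pow_mul_exp_neg k).add (integrableOn_pow_mul_exp_neg (k + 2))
  refine Integrable.mono' hb ?_ ?_
  · have := Real.continuous_mul_log
    exact (by fun_prop : Continuous fun x : ℝ =>
      x ^ k * (x * Real.log x * Real.exp (-x))).aestronglyMeasurable
  · refine (ae_restrict_iff' measurableSet_Ici).mpr (ae_of_all _ fun x hx => ?_)
    have hx : 0 ≤ x := hx
    have h := mul_le_mul_of_nonneg_left (abs_mul_log_le hx)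
      (by positivity : 0 ≤ x ^ k * Real.exp (-x))
    simp only [Pi.add_apply, Real.norm_eq_abs, abs_mul, abs_of_nonneg (pow_nonneg hx k),
      Real.abs_exp] at h ⊢
    calc _ = x ^ k * Real.exp (-x) * (|x| * |Real.log x|) := by ring
      _ ≤ _ := h
      _ = _ := by ring

lemma integral_pow_mul_log_mul_exp_neg (k : ℕ) :
    ∫ x in Set.Ici (0 : ℝ), x ^ k * (x * Real.log x * Real.exp (-x)) =
      ((k + 1).factorial : ℝ) * digammaSucc (k + 1) := by
  have hs : 0 < (((k + 1 : ℕ) : ℂ) + 1).re := by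
    simp only [Complex.add_re, Complex.natCast_re, Complex.one_re]
    positivity
  have h1 := Complex.hasDerivAt_GammaIntegral hs
  have h2 := Complex.hasDerivAt_Gamma_nat (k + 1)
  have h3 : Complex.Gamma =ᶠ[nhds (((k + 1 : ℕ) : ℂ) + 1)] Complex.GammaIntegral := by
    filter_upwards [(isOpen_lt continuous_const Complex.continuous_re).mem_nhds hs] with z hz
    exact Complex.Gamma_eq_integral hz
  have h4 := (h1.congr_of_eventuallyEq h3).unique h2
  rw [integral_Ici_eq_integral_Ioi, digammaSucc_eq_harmonic]
  apply Complex.ofReal_injective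
  rw [← integral_complex_ofReal]
  push_cast at h4 ⊢
  rw [← h4]
  refine setIntegral_congr_fun measurableSet_Ioi fun x _ => ?_
  simp only [add_sub_cancel_right]
  norm_cast
  ring_nf

end Moments

section ForwardDifferences

open Polynomial

lemma descPochhammer_succ_eval' (n : ℕ) (r : ℝ) :
    (descPochhammer ℝ (n + 1)).eval r = (descPochhammer ℝ n).eval r * (r - n) := by
  simp [descPochhammer_succ_right]

lemma derivative_descPochhammer_succ_eval (n : ℕ) (r : ℝ) :
    (derivative (descPochhammer ℝ (n + 1))).eval r =
      (derivative (descPochhammer ℝ n)).eval r * (r - n) + (descPochhammer ℝ n).eval r := by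
  simp [descPochhammer_succ_right, derivative_mul]

lemma derivative_descPochhammer_eval_add (n d : ℕ) :
    (derivative (descPochhammer ℝ n)).eval ((n + d : ℕ) : ℝ) =
      ((n + d).factorial : ℝ) / d.factorial * ((harmonic (n + d) : ℝ) - harmonic d) := by
  induction n generalizing d with
  | zero => simp
  | succ n ih =>
    have h := ih (d + 1)
    rw [show n + (d + 1) = n + 1 + d by ring] at h
    have hdf := Nat.factorial_mul_descFactorial (show n ≤ n + 1 + d by omega)
    rw [show n + 1 + d - n = d + 1 by omega] at hdf
    have hdf' : ((n + 1 + d).descFactorial n : ℝ) =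
        ((n + 1 + d).factorial : ℝ) / (d + 1).factorial := by
      rw [eq_div_iff (by positivity), ← hdf]
      push_cast
      ring
    rw [derivative_descPochhammer_succ_eval, h, descPochhammer_eval_eq_descFactorial, hdf',
      harmonic_succ d, Nat.factorial_succ d]
    push_cast
    field_simp
    ring

lemma derivative_descPochhammer_eval_of_lt (r j : ℕ) :
    (derivative (descPochhammer ℝ (r + 1 + j))).eval (r : ℝ) =
      (-1) ^ j * (r.factorial * j.factorial) := by
  induction j with
  | zero =>
    simp [derivative_descPochhammer_succ_eval, descPochhammer_eval_eq_descFactorial,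
      Nat.descFactorial_self]
  | succ j ih =>
    rw [← add_assoc, derivative_descPochhammer_succ_eval, ih,
      descPochhammer_eval_eq_descFactorial, Nat.descFactorial_of_lt (by omega)]
    push_cast [Nat.factorial_succ]
    ring

/-- Iterated forward differences of `y ↦ (y + r)! / y! * (a * ψ (y + r + 1) + b)`. -/
lemma fwdDiff_iter_factorial_mul_digammaSucc (r : ℕ) (a b : ℝ) (n y : ℕ) :
    (fwdDiff 1)^[n] (fun y : ℕ => ((y + r).factorial : ℝ) / y.factorial *
        (a * digammaSucc (y + r) + b)) y =
      ((y + r).factorial : ℝ) / (y + n).factorial *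
        (a * ((descPochhammer ℝ n).eval (r : ℝ) * digammaSucc (y + r) +
          (derivative (descPochhammer ℝ n)).eval (r : ℝ)) +
          b * (descPochhammer ℝ n).eval (r : ℝ)) := by
  induction n generalizing y with
  | zero => simp
  | succ n ih =>
    rw [Function.iterate_succ_apply', fwdDiff, ih, ih, derivative_descPochhammer_succ_eval,
      descPochhammer_succ_eval', show y + 1 + r = y + r + 1 by ring, digammaSucc_succ,
      show y + 1 + n = y + n + 1 by ring, show y + (n + 1) = y + n + 1 by ring,
      Nat.factorial_succ (y + r), Nat.factorial_succ (y + n)]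
    push_cast
    have h1 : (y : ℝ) + r + 1 ≠ 0 := by positivity
    have h2 : (y : ℝ) + n + 1 ≠ 0 := by positivity
    field_simp
    ring

end ForwardDifferences

section Laguerre

open Polynomial

/-- The monic generalized Laguerre polynomial `(-1) ^ n * n! * L_n^(α)`. -/
def monicLaguerre (α n : ℕ) : ℝ[X] :=
  ∑ i ∈ Finset.range (n + 1),
    C ((-1) ^ (n - i) * (n.choose i : ℝ) * ((n + α).factorial / (i + α).factorial)) * X ^ i

lemma monicLaguerre_coeff {α n i : ℕ} (hi : i ≤ n) :
    (monicLaguerre α n).coeff i =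
      (-1) ^ (n - i) * (n.choose i : ℝ) * ((n + α).factorial / (i + α).factorial) := by
  simp only [monicLaguerre, finsetSum_coeff, coeff_C_mul_X_pow]
  rw [Finset.sum_ite_eq, if_pos (by simpa [Nat.lt_succ_iff] using hi)]

lemma monicLaguerre_natDegree_le (α n : ℕ) : (monicLaguerre α n).natDegree ≤ n :=
  natDegree_sum_le_of_forall_le _ _ fun _ hi =>
    (natDegree_C_mul_X_pow_le _ _).trans (Nat.lt_succ_iff.mp (Finset.mem_range.mp hi))

lemma monicLaguerre_coeff_self (α n : ℕ) : (monicLaguerre α n).coeff n = 1 := by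
  rw [monicLaguerre_coeff le_rfl, div_self (by positivity)]
  simp

lemma monicLaguerre_monic (α n : ℕ) : (monicLaguerre α n).Monic :=
  monic_of_natDegree_le_of_coeff_eq_one n (monicLaguerre_natDegree_le α n)
    (monicLaguerre_coeff_self α n)

lemma monicLaguerre_natDegree (α n : ℕ) : (monicLaguerre α n).natDegree = n :=
  natDegree_eq_of_le_of_coeff_ne_zero (monicLaguerre_natDegree_le α n)
    (by simp [monicLaguerre_coeff_self])

lemma sum_monicLaguerre_coeff_mul (α n r : ℕ) (a b : ℝ) :
    ∑ i ∈ Finset.range (n + 1), (monicLaguerre α n).coeff i *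
        (((α + r + i).factorial : ℝ) * (a * digammaSucc (α + r + i) + b)) =
      ((α + r).factorial : ℝ) *
        (a * ((descPochhammer ℝ n).eval (r : ℝ) * digammaSucc (α + r) +
          (derivative (descPochhammer ℝ n)).eval (r : ℝ)) +
          b * (descPochhammer ℝ n).eval (r : ℝ)) := by
  have h := fwdDiff_iter_factorial_mul_digammaSucc r a b n α
  rw [fwdDiff_iter_eq_sum_shift] at h
  have h2 := congrArg (fun t => ((n + α).factorial : ℝ) * t) h
  simp only [Finset.mul_sum] at h2
  calc _ = _ := ?_
    _ = _ := h2
    _ = _ := ?_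
  · refine Finset.sum_congr rfl fun i hi => ?_
    rw [monicLaguerre_coeff (Nat.lt_succ_iff.mp (Finset.mem_range.mp hi)),
      show α + i • 1 + r = α + r + i by simp; ring, show α + i • 1 = i + α by simp; ring]
    simp only [zsmul_eq_mul]
    push_cast
    ring
  · rw [add_comm α n]
    field_simp

variable {μ : Measure ℝ} {g : ℝ → ℝ}

lemma integrable_eval_mul (hg : ∀ k : ℕ, Integrable (fun x => x ^ k * g x) μ) (q : ℝ[X]) :
    Integrable (fun x => q.eval x * g x) μ := by
  simp_rw [eval_eq_sum_range, Finset.sum_mul, mul_assoc]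
  exact integrable_finsetSum _ fun i _ => (hg i).const_mul _

lemma integral_eval_mul (hg : ∀ k : ℕ, Integrable (fun x => x ^ k * g x) μ) (q : ℝ[X]) :
    ∫ x, q.eval x * g x ∂μ =
      ∑ i ∈ Finset.range (q.natDegree + 1), q.coeff i * ∫ x, x ^ i * g x ∂μ := by
  simp_rw [eval_eq_sum_range, Finset.sum_mul, mul_assoc]
  rw [integral_finsetSum _ fun i _ => (hg i).const_mul _]
  simp_rw [integral_const_mul]

lemma integrable_eval_mul_eval_mul (hg : ∀ k : ℕ, Integrable (fun x => x ^ k * g x) μ)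
    (α : ℕ) (p q : ℝ[X]) :
    Integrable (fun x => p.eval x * q.eval x * (x ^ α * g x)) μ := by
  convert integrable_eval_mul hg (p * q * X ^ α) using 2
  simp only [eval_mul, eval_pow, eval_X]
  ring

lemma integral_eval_mul_monicLaguerre_mul
    (hg : ∀ k : ℕ, Integrable (fun x => x ^ k * g x) μ) (α n : ℕ) (q : ℝ[X]) :
    ∫ x, q.eval x * (monicLaguerre α n).eval x * (x ^ α * g x) ∂μ =
      ∑ r ∈ Finset.range (q.natDegree + 1), q.coeff r *
        ∑ i ∈ Finset.range (n + 1), (monicLaguerre α n).coeff i *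
          ∫ x, x ^ (α + r + i) * g x ∂μ := by
  have h1 (r k : ℕ) : Integrable (fun x => x ^ k * (x ^ (α + r) * g x)) μ := by
    convert hg (k + (α + r)) using 2
    ring
  have h2 (r : ℕ) : Integrable
      (fun x => x ^ r * ((monicLaguerre α n).eval x * (x ^ α * g x))) μ := by
    convert integrable_eval_mul_eval_mul hg α (X ^ r) (monicLaguerre α n) using 2
    simp only [eval_pow, eval_X]
    ring
  simp_rw [mul_assoc]
  rw [integral_eval_mul h2]
  refine Finset.sum_congr rfl fun r _ => ?_
  have h3 : ∫ x, x ^ r * ((monicLaguerre α n).eval x * (x ^ α * g x)) ∂μ =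
      ∫ x, (monicLaguerre α n).eval x * (x ^ (α + r) * g x) ∂μ :=
    integral_congr_ae (ae_of_all _ fun x => by ring)
  rw [h3, integral_eval_mul (h1 r), monicLaguerre_natDegree]
  congr 1
  refine Finset.sum_congr rfl fun i _ => ?_
  congr 1
  exact integral_congr_ae (ae_of_all _ fun x => by ring)

lemma integral_eval_mul_monicLaguerre (α n : ℕ) (q : ℝ[X]) :
    ∫ x in Set.Ici 0, q.eval x * (monicLaguerre α n).eval x * (x ^ α * Real.exp (-x)) =
      ∑ r ∈ Finset.range (q.natDegree + 1), q.coeff r *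
        (((α + r).factorial : ℝ) * (r.descFactorial n : ℝ)) := by
  rw [integral_eval_mul_monicLaguerre_mul integrableOn_pow_mul_exp_neg]
  refine Finset.sum_congr rfl fun r _ => ?_
  have h := sum_monicLaguerre_coeff_mul α n r 0 1
  simp only [zero_mul, zero_add, mul_one, one_mul, descPochhammer_eval_eq_descFactorial] at h
  simp_rw [integral_pow_mul_exp_neg, h]

lemma integral_monicLaguerre_mul_self (α n : ℕ) :
    ∫ x in Set.Ici 0, (monicLaguerre α n).eval x * (monicLaguerre α n).eval x *
      (x ^ α * Real.exp (-x)) = (n.factorial : ℝ) * (α + n).factorial := by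
  rw [integral_eval_mul_monicLaguerre, monicLaguerre_natDegree, Finset.sum_range_succ,
    Finset.sum_eq_zero, monicLaguerre_coeff_self, Nat.descFactorial_self]
  · ring
  · intro r hr
    simp [Nat.descFactorial_of_lt (Finset.mem_range.mp hr)]

lemma integral_monicLaguerre_mul_of_ne (α : ℕ) {i j : ℕ} (hij : i ≠ j) :
    ∫ x in Set.Ici 0, (monicLaguerre α i).eval x * (monicLaguerre α j).eval x *
      (x ^ α * Real.exp (-x)) = 0 := by
  wlog h : i < j generalizing i j
  · simp_rw [mul_comm ((monicLaguerre α i).eval _)]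
    exact this hij.symm (by omega)
  rw [integral_eval_mul_monicLaguerre, monicLaguerre_natDegree]
  refine Finset.sum_eq_zero fun r hr => ?_
  have hr := Finset.mem_range.mp hr
  simp [Nat.descFactorial_of_lt (show r < j by omega)]

lemma sum_mul_div_eq_harmonic (a b : ℝ) (K : ℕ) :
    ∑ j ∈ Finset.range K, (a - (j + 1)) * (b - (j + 1)) / (((j : ℝ) + 1) * (j + 2)) =
      a * b * (1 - 1 / (K + 1)) - (a + b + 1) * ((harmonic (K + 1) : ℝ) - 1) + K := by
  induction K with
  | zero => simp
  | succ K ih =>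
    rw [Finset.sum_range_succ, ih, harmonic_succ (K + 1)]
    push_cast
    have h1 : (K : ℝ) + 1 ≠ 0 := by positivity
    have h2 : (K : ℝ) + 2 ≠ 0 := by positivity
    have h3 : (K : ℝ) + 1 + 1 ≠ 0 := by positivity
    field_simp
    ring

lemma integral_mul_log_mul_monicLaguerre_sq (α n : ℕ) :
    ∫ x in Set.Ici 0, (monicLaguerre α n).eval x * (monicLaguerre α n).eval x *
      (x * Real.log x * (x ^ α * Real.exp (-x))) =
    (n.factorial : ℝ) * (α + n).factorial *
      (1 + 2 * n + (2 * n + α + 1) * digammaSucc (n + α)) := by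
  have h0 (x : ℝ) : x * Real.log x * (x ^ α * Real.exp (-x)) =
      x ^ α * (x * Real.log x * Real.exp (-x)) := by ring
  simp_rw [h0]
  rw [integral_eval_mul_monicLaguerre_mul integrableOn_pow_mul_log_mul_exp_neg,
    monicLaguerre_natDegree]
  have hr (r : ℕ) : ∑ i ∈ Finset.range (n + 1), (monicLaguerre α n).coeff i *
      ∫ x in Set.Ici 0, x ^ (α + r + i) * (x * Real.log x * Real.exp (-x)) =
      ((α + r + 1).factorial : ℝ) * (((r + 1).descFactorial n : ℝ) * digammaSucc (α + r + 1) +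
          (derivative (descPochhammer ℝ n)).eval ((r + 1 : ℕ) : ℝ)) := by
    have h := sum_monicLaguerre_coeff_mul α n (r + 1) 1 0
    simp only [zero_mul, add_zero, one_mul, descPochhammer_eval_eq_descFactorial] at h
    rw [← add_assoc] at h
    rw [← h]
    simp_rw [integral_pow_mul_log_mul_exp_neg]
    refine Finset.sum_congr rfl fun i _ => ?_
    rw [show α + r + 1 + i = α + r + i + 1 by ring]
  simp_rw [hr]
  obtain _ | N := n
  · simp [monicLaguerre_coeff, digammaSucc_succ, Nat.factorial_succ]
    field_simp
    ring
  rw [Finset.sum_range_succ, Finset.sum_range_succ]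
  have hsum : ∑ r ∈ Finset.range N, (monicLaguerre α (N + 1)).coeff r *
      (((α + r + 1).factorial : ℝ) *
        (((r + 1).descFactorial (N + 1) : ℝ) * digammaSucc (α + r + 1) +
          (derivative (descPochhammer ℝ (N + 1))).eval ((r + 1 : ℕ) : ℝ))) =
      ((N + 1).factorial : ℝ) * (α + (N + 1)).factorial *
      ∑ j ∈ Finset.range N, ((α + N + 1 : ℝ) - (j + 1)) * ((N + 1 : ℝ) - (j + 1)) /
        (((j : ℝ) + 1) * (j + 2)) := by
    rw [← Finset.sum_range_reflect, Finset.mul_sum]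
    refine Finset.sum_congr rfl fun j hj => ?_
    obtain ⟨r, rfl⟩ : ∃ r, N = r + 1 + j :=
      ⟨N - 1 - j, by have := Finset.mem_range.mp hj; omega⟩
    have hd := derivative_descPochhammer_eval_of_lt (r + 1) j
    rw [show r + 1 + j - 1 - j = r by omega, monicLaguerre_coeff (by omega),
      Nat.descFactorial_of_lt (by omega), show r + 1 + j + 1 = r + 1 + 1 + j by ring, hd,
      Nat.cast_choose ℝ (by omega : r ≤ r + 1 + 1 + j),
      show r + 1 + 1 + j - r = j + 1 + 1 by omega, add_comm r α,
      add_comm (r + 1 + 1 + j) α, Nat.factorial_succ (α + r), Nat.factorial_succ r,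
      Nat.factorial_succ (j + 1), Nat.factorial_succ j]
    have hs : (-1 : ℝ) ^ (j * 2) = 1 := by simp [pow_mul']
    push_cast
    field_simp
    ring_nf
    simp only [hs]
    ring
  rw [hsum, sum_mul_div_eq_harmonic]
  have d1 := derivative_descPochhammer_eval_add (N + 1) 0
  have d2 := derivative_descPochhammer_eval_add (N + 1) 1
  rw [d2, monicLaguerre_coeff_self, monicLaguerre_coeff (Nat.le_succ N)]
  rw [add_zero] at d1
  rw [d1, Nat.descFactorial_self]
  have hdf := Nat.factorial_mul_descFactorial (show N + 1 ≤ N + 1 + 1 by omega)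
  rw [show N + 1 + 1 - (N + 1) = 1 by omega, Nat.factorial_one, one_mul] at hdf
  rw [hdf, harmonic_succ (N + 1), show α + (N + 1) + 1 = N + 1 + α + 1 by ring,
    show α + N + 1 = N + 1 + α by ring, show α + (N + 1) = N + 1 + α by ring,
    show N + 1 - N = 1 by omega, Nat.choose_succ_self_right, digammaSucc_succ (N + 1 + α),
    show N + 1 + α = N + α + 1 by ring, Nat.factorial_succ (N + α + 1),
    Nat.factorial_succ (N + α), Nat.factorial_succ (N + 1), Nat.factorial_succ N,
    Nat.factorial_one, Nat.factorial_zero, harmonic_zero, harmonic_succ 0, harmonic_zero]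
  push_cast
  have h1 : (N : ℝ) + α + 1 + 1 ≠ 0 := by positivity
  field_simp
  ring

end Laguerre

/-- For `1 ≤ m ≤ n`, the mean of `∑ x_l ln x_l` for the
Laguerre (Wishart) eigenvalue ensemble with parameter `α = n − m`:
the ratio of `∫_{[0,∞)^m} (∑ x_l ln x_l) ∏_{j<k}(x_k−x_j)² ∏_j x_j^{n−m} e^{−x_j} dx`
to `∫_{[0,∞)^m} ∏_{j<k}(x_k−x_j)² ∏_j x_j^{n−m} e^{−x_j} dx` equals
`∑_{k=0}^{m−1} [1 + 2k + (2k+n−m+1) ψ(k+n−m+1)]`. -/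
theorem laguerre_ensemble_log_mean (m n : ℕ) (hm : 1 ≤ m) (hmn : m ≤ n) :
    (∫ x in {x : Fin m → ℝ | ∀ j, 0 ≤ x j},
        (∑ l, x l * Real.log (x l)) *
          ((∏ j, ∏ k ∈ Finset.Ioi j, (x k - x j) ^ 2) *
            ∏ j, x j ^ (n - m) * Real.exp (-x j))) /
    (∫ x in {x : Fin m → ℝ | ∀ j, 0 ≤ x j},
        (∏ j, ∏ k ∈ Finset.Ioi j, (x k - x j) ^ 2) *
          ∏ j, x j ^ (n - m) * Real.exp (-x j)) =
      ∑ k ∈ Finset.range m,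
        (1 + 2 * (k : ℝ) +
          (2 * (k : ℝ) + ((n - m : ℕ) : ℝ) + 1) * digammaSucc (k + (n - m))) := by
  generalize n - m = α
  have hset : {x : Fin m → ℝ | ∀ j, 0 ≤ x j} = Set.univ.pi fun _ => Set.Ici 0 := by
    ext x
    simp [Pi.le_def]
  have hdet (x : Fin m → ℝ) : ∏ j, ∏ k ∈ Finset.Ioi j, (x k - x j) ^ 2 =
      (Matrix.of fun i j : Fin m => (monicLaguerre α j).eval (x i)).det ^ 2 := by
    rw [← Matrix.det_eval_matrixOfPolynomials_eq_det_vandermonde x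
      (fun j : Fin m => monicLaguerre α j) (fun j => monicLaguerre_natDegree α j)
      (fun j => monicLaguerre_monic α j), Matrix.det_vandermonde]
    simp_rw [Finset.prod_pow]
  rw [hset, volume_pi, Measure.restrict_pi_pi]
  simp_rw [hdet]
  rw [integral_sum_mul_det_sq_div (φ := fun (j : Fin m) x => (monicLaguerre α j).eval x)
    (w := fun x => x ^ α * Real.exp (-x)) (f := fun x => x * Real.log x) hm]
  · rw [← Fin.sum_univ_eq_sum_range (fun k : ℕ => 1 + 2 * (k : ℝ) +
          (2 * (k : ℝ) + (α : ℝ) + 1) * digammaSucc (k + α))]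
    refine Finset.sum_congr rfl fun k _ => ?_
    rw [integral_mul_log_mul_monicLaguerre_sq, integral_monicLaguerre_mul_self,
      mul_div_cancel_left₀ _ (by positivity)]
  · exact fun a b => integrable_eval_mul_eval_mul integrableOn_pow_mul_exp_neg α _ _
  · intro a b
    refine (integrable_eval_mul_eval_mul integrableOn_pow_mul_log_mul_exp_neg α
      (monicLaguerre α a) (monicLaguerre α b)).congr (ae_of_all _ fun x => ?_)
    ring
  · exact fun a b hab => integral_monicLaguerre_mul_of_ne α (Fin.val_ne_of_ne hab)
  · intro a
    rw [integral_monicLaguerre_mul_self]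
    positivity
end
end

section
/- For all integers 1 ≤ m ≤ n, the following identity of rational numbers holds: m/n + (1/(mn))·Σ_{k=0}^{m−1} (2k+n−m+1)·H_{n−m+k} = H_n + (m−1)/(2n), where H_N = Σ_{r=1}^N 1/r (with H_0 = 0). -/
/-- Summation by parts for harmonic numbers with linear weights. -/
theorem sum_range_mul_harmonic_add (d m : ℕ) :
    ∑ k ∈ Finset.range m, (2 * (k : ℚ) + d + 1) * harmonic (d + k) =
      m * (d + m) * harmonic (d + m) - m * (m + 1) / 2 := by
  induction m with
  | zero => simp
  | succ m ih =>
    have h : (d : ℚ) + m + 1 ≠ 0 := by positivity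
    rw [Finset.sum_range_succ, ih, ← add_assoc d m 1, harmonic_succ]
    push_cast
    field_simp
    ring

/-- For all integers `1 ≤ m ≤ n`,
`m/n + (1/(mn)) ∑_{k=0}^{m−1} (2k+n−m+1) H_{n−m+k} = H_n + (m−1)/(2n)`,
where `H_N = ∑_{r=1}^N 1/r` is the `N`-th harmonic number (`H_0 = 0`). -/
theorem harmonic_core_identity (m n : ℕ) (hm : 1 ≤ m) (hmn : m ≤ n) :
    (m : ℚ) / n + 1 / ((m : ℚ) * n) *
        ∑ k ∈ Finset.range m,
          (2 * (k : ℚ) + n - m + 1) * harmonic (n - m + k) =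
      harmonic n + ((m : ℚ) - 1) / (2 * n) := by
  obtain ⟨d, rfl⟩ := Nat.exists_eq_add_of_le' hmn
  have hm0 : (m : ℚ) ≠ 0 := by exact_mod_cast (by omega : m ≠ 0)
  have hn0 : (d : ℚ) + m ≠ 0 := by positivity
  have hsum : ∑ k ∈ Finset.range m,
      (2 * (k : ℚ) + (d + m : ℕ) - m + 1) * harmonic (d + m - m + k) =
        m * (d + m) * harmonic (d + m) - m * (m + 1) / 2 := by
    rw [← sum_range_mul_harmonic_add, Nat.add_sub_cancel]
    refine Finset.sum_congr rfl fun k _ => ?_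
    push_cast
    ring
  rw [hsum]
  push_cast
  field_simp
  ring
end

section
/- For every integer k ≥ 1 and real α > −1, the partial derivative of the generalized Laguerre polynomial with respect to the parameter α satisfies (∂/∂α) L_k^{(α)}(x) = Σ_{j=0}^{k−1} L_j^{(α)}(x)/(k−j), as an identity of polynomials in x (i.e. it holds for every x ∈ ℝ). -/
open MeasureTheory

noncomputable section

/-- The generalized Laguerre polynomial
`L_k^{(α)}(x) = ∑_{j=0}^k (−1)^j [Γ(k+α+1)/(Γ(j+α+1)(k−j)!)] x^j/j!`. -/
def laguerre (α : ℝ) (k : ℕ) (x : ℝ) : ℝ :=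
  ∑ j ∈ Finset.range (k + 1),
    (-1 : ℝ) ^ j *
      (Real.Gamma (k + α + 1) / (Real.Gamma (j + α + 1) * (Nat.factorial (k - j)))) *
      x ^ j / (Nat.factorial j)

/-- The coefficient of `t ^ m` in `(1 - t) ^ (-b)`, namely `b (b + 1) ⋯ (b + m - 1) / m!`. -/
def negBinomCoeff (m : ℕ) (b : ℝ) : ℝ :=
  (ascPochhammer ℝ m).eval b / (Nat.factorial m)

lemma negBinomCoeff_zero (b : ℝ) : negBinomCoeff 0 b = 1 := by
  simp [negBinomCoeff]

lemma negBinomCoeff_succ (m : ℕ) (b : ℝ) :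
    negBinomCoeff (m + 1) b = negBinomCoeff m b * (b + m) / (m + 1) := by
  have h : (Nat.factorial m : ℝ) ≠ 0 := by positivity
  have h' : (m : ℝ) + 1 ≠ 0 := by positivity
  simp only [negBinomCoeff, ascPochhammer_succ_eval, Nat.factorial_succ]
  push_cast
  field_simp

lemma negBinomCoeff_eq_Gamma (m : ℕ) {b : ℝ} (hb : 0 < b) :
    negBinomCoeff m b = Real.Gamma (b + m) / (Real.Gamma b * (Nat.factorial m)) := by
  have hG : Real.Gamma b ≠ 0 := (Real.Gamma_pos_of_pos hb).ne'
  induction m with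
  | zero => simp [negBinomCoeff_zero, hG]
  | succ m ih =>
    have h : (Nat.factorial m : ℝ) ≠ 0 := by positivity
    have h' : (m : ℝ) + 1 ≠ 0 := by positivity
    have hbm : b + m ≠ 0 := by positivity
    rw [negBinomCoeff_succ, ih, Nat.factorial_succ]
    push_cast
    rw [← add_assoc, Real.Gamma_add_one hbm]
    field_simp

lemma sum_negBinomCoeff_succ (m : ℕ) (b : ℝ) :
    (∑ i ∈ Finset.range (m + 1), negBinomCoeff i b / ((m : ℝ) + 1 - i)) * (m + 1) =
      (∑ i ∈ Finset.range m, negBinomCoeff i b / ((m : ℝ) - i)) * (b + m) +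
        negBinomCoeff m b := by
  have hl : ∀ i ∈ Finset.range (m + 1),
      negBinomCoeff i b / ((m : ℝ) + 1 - i) * (m + 1) =
        negBinomCoeff i b + i * negBinomCoeff i b / ((m : ℝ) + 1 - i) := by
    intro i hi
    have : (i : ℝ) < m + 1 := by exact_mod_cast Finset.mem_range.1 hi
    have : (m : ℝ) + 1 - i ≠ 0 := by linarith
    field_simp
    ring
  have hr : ∀ i ∈ Finset.range m,
      negBinomCoeff i b / ((m : ℝ) - i) * (b + m) =
        negBinomCoeff i b +
          ((i + 1 : ℕ) : ℝ) * negBinomCoeff (i + 1) b / ((m : ℝ) + 1 - (i + 1 : ℕ)) := by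
    intro i hi
    have : (i : ℝ) < m := by exact_mod_cast Finset.mem_range.1 hi
    have : (m : ℝ) - i ≠ 0 := by linarith
    have h' : (i : ℝ) + 1 ≠ 0 := by positivity
    rw [negBinomCoeff_succ]
    push_cast
    rw [add_sub_add_right_eq_sub]
    field_simp
    ring
  rw [Finset.sum_mul, Finset.sum_mul, Finset.sum_congr rfl hl, Finset.sum_congr rfl hr,
    Finset.sum_add_distrib, Finset.sum_add_distrib, Finset.sum_range_succ,
    Finset.sum_range_succ' (fun i : ℕ => (i : ℝ) * negBinomCoeff i b / ((m : ℝ) + 1 - i))]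
  simp only [Nat.cast_zero, zero_mul, zero_div]
  ring

lemma hasDerivAt_negBinomCoeff (m : ℕ) (b : ℝ) :
    HasDerivAt (negBinomCoeff m)
      (∑ i ∈ Finset.range m, negBinomCoeff i b / ((m : ℝ) - i)) b := by
  induction m with
  | zero =>
    rw [funext negBinomCoeff_zero]
    simpa using hasDerivAt_const b (1 : ℝ)
  | succ m ih =>
    have h' : (m : ℝ) + 1 ≠ 0 := by positivity
    rw [funext (negBinomCoeff_succ m)]
    refine ((ih.fun_mul ((hasDerivAt_id b).add_const (m : ℝ))).div_const
      ((m : ℝ) + 1)).congr_deriv ?_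
    push_cast
    rw [div_eq_iff h', sum_negBinomCoeff_succ]
    simp

lemma laguerre_eq_sum_negBinomCoeff (k : ℕ) {a : ℝ} (ha : -1 < a) (x : ℝ) :
    laguerre a k x = ∑ j ∈ Finset.range (k + 1),
      (-1 : ℝ) ^ j * negBinomCoeff (k - j) (j + a + 1) * x ^ j / (Nat.factorial j) := by
  refine Finset.sum_congr rfl fun j hj => ?_
  have hjk : j ≤ k := Finset.mem_range_succ_iff.1 hj
  have hj0 : (0 : ℝ) ≤ j := j.cast_nonneg
  rw [negBinomCoeff_eq_Gamma (k - j) (by linarith), Nat.cast_sub hjk]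
  congr 5
  ring

lemma hasDerivAt_laguerre (k : ℕ) {a : ℝ} (ha : -1 < a) (x : ℝ) :
    HasDerivAt (fun a : ℝ => laguerre a k x)
      (∑ j ∈ Finset.range (k + 1), (-1 : ℝ) ^ j *
        (∑ i ∈ Finset.range (k - j), negBinomCoeff i (j + a + 1) / (((k - j : ℕ) : ℝ) - i)) *
        x ^ j / (Nat.factorial j)) a := by
  have hsum : HasDerivAt
      (fun a : ℝ => ∑ j ∈ Finset.range (k + 1),
        (-1 : ℝ) ^ j * negBinomCoeff (k - j) (j + a + 1) * x ^ j / (Nat.factorial j)) _ a :=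
    HasDerivAt.fun_sum fun j _ =>
      ((((hasDerivAt_negBinomCoeff (k - j) (j + a + 1)).comp a
        (((hasDerivAt_id a).const_add (j : ℝ)).add_const 1)).const_mul
          ((-1 : ℝ) ^ j)).mul_const (x ^ j)).div_const _
  simp only [mul_one] at hsum
  refine hsum.congr_of_eventuallyEq ?_
  filter_upwards [lt_mem_nhds ha] with c hc
  exact laguerre_eq_sum_negBinomCoeff k hc x

/-- For `k ≥ 1` and `α > −1`, the derivative of the
generalized Laguerre polynomial with respect to the parameter `α` satisfies
`(∂/∂α) L_k^{(α)}(x) = ∑_{j=0}^{k−1} L_j^{(α)}(x)/(k−j)` for every `x ∈ ℝ`. -/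
theorem laguerre_param_deriv (k : ℕ) (hk : 1 ≤ k) (α : ℝ) (hα : -1 < α) (x : ℝ) :
    HasDerivAt (fun a : ℝ => laguerre a k x)
      (∑ j ∈ Finset.range k, laguerre α j x / ((k : ℝ) - j)) α := by
  convert hasDerivAt_laguerre k hα x using 1
  rw [Finset.sum_range_succ]
  simp only [Nat.sub_self, Finset.range_zero, Finset.sum_empty, mul_zero, zero_mul, zero_div,
    add_zero]
  let f : ℕ → ℕ → ℝ := fun j i =>
    (-1 : ℝ) ^ j * (negBinomCoeff i (j + α + 1) / ((k : ℝ) - j - i)) * x ^ j / (Nat.factorial j)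
  have hl : ∀ n ∈ Finset.range k,
      laguerre α n x / ((k : ℝ) - n) = ∑ j ∈ Finset.range (n + 1), f j (n - j) := by
    intro n _
    rw [laguerre_eq_sum_negBinomCoeff n hα, Finset.sum_div]
    refine Finset.sum_congr rfl fun j hj => ?_
    simp only [f]
    rw [Nat.cast_sub (Finset.mem_range_succ_iff.1 hj), sub_sub, add_sub_cancel]
    ring
  rw [Finset.sum_congr rfl hl, Finset.sum_range_diag_flip]
  refine Finset.sum_congr rfl fun j hj => ?_
  rw [Nat.cast_sub (Finset.mem_range.1 hj).le, Finset.mul_sum, Finset.sum_mul, Finset.sum_div]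
end
end

section
/- For every integer k ≥ 1 and real α > −1, ∫_0^∞ x^{α+1} L_k^{(α)}(x) · [(∂/∂α) L_k^{(α)}](x) · e^{−x} dx = −Γ(k+α+1)/(k−1)!, where the derivative of the generalized Laguerre polynomial in the parameter α is taken coefficientwise. -/
open MeasureTheory

noncomputable section

theorem Gamma_add_natCast_eq_ascPochhammer_mul (s : ℝ) (hs : 0 < s) (m : ℕ) :
    Real.Gamma (s + m) = (ascPochhammer ℝ m).eval s * Real.Gamma s := by
  induction m with
  | zero => simp
  | succ m ih =>
    have h : s + m ≠ 0 := by positivity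
    rw [Nat.cast_succ, ← add_assoc, Real.Gamma_add_one h, ih, ascPochhammer_succ_eval]
    ring

theorem sum_neg_one_pow_mul_choose_mul_eval (P : Polynomial ℝ) (k : ℕ) (y : ℝ) :
    ∑ j ∈ Finset.range (k + 1), (-1 : ℝ) ^ j * k.choose j * P.eval (y + j) =
      (-1) ^ k * (fwdDiff 1)^[k] P.eval y := by
  rw [fwdDiff_iter_eq_sum_shift, Finset.mul_sum]
  refine Finset.sum_congr rfl fun j hj => ?_
  obtain ⟨i, rfl⟩ := Nat.exists_eq_add_of_le (Finset.mem_range_succ_iff.mp hj)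
  have h : (-1 : ℝ) ^ i * (-1) ^ i = 1 := by rw [← mul_pow]; simp
  simp only [Nat.add_sub_cancel_left, zsmul_eq_mul, nsmul_eq_mul, mul_one, pow_add]
  push_cast
  linear_combination (-(-1 : ℝ) ^ j * (j + i).choose j * P.eval (y + j)) * h

/-- The coefficient of `x ^ j` in `L_k^{(α)}(x)`. -/
def laguerreCoeff (α : ℝ) (k j : ℕ) : ℝ :=
  (-1 : ℝ) ^ j * (Real.Gamma (k + α + 1) / (Real.Gamma (j + α + 1) * (Nat.factorial (k - j)))) /
    (Nat.factorial j)

theorem laguerre_eq_sum (α : ℝ) (k : ℕ) (x : ℝ) :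
    laguerre α k x = ∑ j ∈ Finset.range (k + 1), laguerreCoeff α k j * x ^ j :=
  Finset.sum_congr rfl fun j _ => by rw [laguerreCoeff]; ring

theorem natCast_add_add_one_pos {α : ℝ} (hα : -1 < α) (j : ℕ) : 0 < (j : ℝ) + α + 1 := by
  have : (0 : ℝ) ≤ j := j.cast_nonneg
  linarith

theorem sum_laguerreCoeff_mul_Gamma {α : ℝ} (hα : -1 < α) (k m : ℕ) :
    ∑ j ∈ Finset.range (k + 1), laguerreCoeff α k j * Real.Gamma (j + α + 1 + m) =
      Real.Gamma (k + α + 1) / (Nat.factorial k) *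
        ((-1) ^ k * (fwdDiff 1)^[k] (ascPochhammer ℝ m).eval (α + 1)) := by
  rw [← sum_neg_one_pow_mul_choose_mul_eval, Finset.mul_sum]
  refine Finset.sum_congr rfl fun j hj => ?_
  have hpos := natCast_add_add_one_pos hα j
  have hΓ := (Real.Gamma_pos_of_pos hpos).ne'
  rw [Gamma_add_natCast_eq_ascPochhammer_mul _ hpos, laguerreCoeff,
    Nat.cast_choose ℝ (Finset.mem_range_succ_iff.mp hj),
    show α + 1 + (j : ℝ) = j + α + 1 by ring]
  field_simp

theorem integrableOn_exp_neg_mul_rpow {s : ℝ} (hs : -1 < s) :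
    IntegrableOn (fun x : ℝ => Real.exp (-x) * x ^ s) (Set.Ioi 0) := by
  simpa using Real.GammaIntegral_convergent (s := s + 1) (by linarith)

theorem integral_rexp_neg_mul_rpow {s : ℝ} (hs : -1 < s) :
    ∫ x in Set.Ioi (0 : ℝ), Real.exp (-x) * x ^ s = Real.Gamma (s + 1) := by
  simpa using (Real.Gamma_eq_integral (s := s + 1) (by linarith)).symm

theorem rpow_mul_laguerre_mul_exp_eq_sum (α : ℝ) (k m : ℕ) {x : ℝ} (hx : 0 < x) :
    x ^ (α + m) * laguerre α k x * Real.exp (-x) =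
      ∑ j ∈ Finset.range (k + 1),
        laguerreCoeff α k j * (Real.exp (-x) * x ^ (α + m + j)) := by
  rw [laguerre_eq_sum, Finset.mul_sum, Finset.sum_mul]
  refine Finset.sum_congr rfl fun j _ => ?_
  rw [Real.rpow_add_natCast hx.ne' (α + m) j]
  ring

theorem neg_one_lt_add_natCast_add_natCast {α : ℝ} (hα : -1 < α) (m j : ℕ) :
    -1 < α + m + j := by
  have := natCast_add_add_one_pos hα j
  have : (0 : ℝ) ≤ m := m.cast_nonneg
  linarith

theorem integrableOn_rpow_mul_laguerre_mul_exp {α : ℝ} (hα : -1 < α) (k m : ℕ) :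
    IntegrableOn (fun x : ℝ => x ^ (α + m) * laguerre α k x * Real.exp (-x)) (Set.Ioi 0) := by
  refine IntegrableOn.congr_fun ?_
    (fun x hx => (rpow_mul_laguerre_mul_exp_eq_sum α k m hx).symm) measurableSet_Ioi
  exact integrable_finsetSum _ fun j _ =>
    (integrableOn_exp_neg_mul_rpow (neg_one_lt_add_natCast_add_natCast hα m j)).const_mul _

theorem integral_rpow_mul_laguerre_mul_exp {α : ℝ} (hα : -1 < α) (k m : ℕ) :
    ∫ x in Set.Ioi (0 : ℝ), x ^ (α + m) * laguerre α k x * Real.exp (-x) =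
      Real.Gamma (k + α + 1) / (Nat.factorial k) *
        ((-1) ^ k * (fwdDiff 1)^[k] (ascPochhammer ℝ m).eval (α + 1)) := by
  rw [setIntegral_congr_fun measurableSet_Ioi
    fun x hx => rpow_mul_laguerre_mul_exp_eq_sum α k m hx, integral_finsetSum _ fun j _ =>
    (integrableOn_exp_neg_mul_rpow (neg_one_lt_add_natCast_add_natCast hα m j)).const_mul _,
    ← sum_laguerreCoeff_mul_Gamma hα]
  refine Finset.sum_congr rfl fun j _ => ?_
  rw [integral_const_mul, integral_rexp_neg_mul_rpow (neg_one_lt_add_natCast_add_natCast hα m j)]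
  ring_nf

theorem integral_rpow_mul_laguerre_mul_exp_of_lt {α : ℝ} (hα : -1 < α) {k m : ℕ} (hm : m < k) :
    ∫ x in Set.Ioi (0 : ℝ), x ^ (α + m) * laguerre α k x * Real.exp (-x) = 0 := by
  rw [integral_rpow_mul_laguerre_mul_exp hα, Polynomial.fwdDiff_iter_eq_zero_of_degree_lt
    (by rwa [ascPochhammer_natDegree])]
  simp

theorem integral_rpow_mul_laguerre_mul_exp_self {α : ℝ} (hα : -1 < α) (k : ℕ) :
    ∫ x in Set.Ioi (0 : ℝ), x ^ (α + k) * laguerre α k x * Real.exp (-x) =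
      (-1) ^ k * Real.Gamma (k + α + 1) := by
  have h := Polynomial.fwdDiff_iter_degree_eq_factorial (ascPochhammer ℝ k)
  rw [ascPochhammer_natDegree, (monic_ascPochhammer ℝ k).leadingCoeff, one_smul] at h
  have : (Nat.factorial k : ℝ) ≠ 0 := by positivity
  rw [integral_rpow_mul_laguerre_mul_exp hα, h, Pi.natCast_apply]
  field_simp

theorem differentiableAt_Gamma_natCast_add {α : ℝ} (hα : -1 < α) (j : ℕ) :
    DifferentiableAt ℝ (fun a : ℝ => Real.Gamma (j + a + 1)) α := by
  have h : DifferentiableAt ℝ Real.Gamma (j + α + 1) :=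
    Real.differentiableOn_Gamma_Ioi.differentiableAt
      (Ioi_mem_nhds (natCast_add_add_one_pos hα j))
  exact h.comp α (f := fun a : ℝ => (j : ℝ) + a + 1) (by fun_prop)

theorem differentiableAt_laguerreCoeff {α : ℝ} (hα : -1 < α) (k j : ℕ) :
    DifferentiableAt ℝ (fun a => laguerreCoeff a k j) α := by
  have hΓ := (Real.Gamma_pos_of_pos (natCast_add_add_one_pos hα j)).ne'
  exact (((differentiableAt_Gamma_natCast_add hα k).div
    ((differentiableAt_Gamma_natCast_add hα j).mul_const _)
    (mul_ne_zero hΓ (by positivity))).const_mul _).div_const _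

theorem deriv_laguerreCoeff_self {α : ℝ} (hα : -1 < α) (k : ℕ) :
    deriv (fun a => laguerreCoeff a k k) α = 0 := by
  have h : (fun a => laguerreCoeff a k k) =ᶠ[nhds α]
      fun _ => (-1 : ℝ) ^ k / (Nat.factorial k) := by
    filter_upwards [Ioi_mem_nhds hα] with a ha
    have hΓ := (Real.Gamma_pos_of_pos (natCast_add_add_one_pos ha k)).ne'
    simp [laguerreCoeff, hΓ]
  rw [h.deriv_eq, deriv_const]

theorem deriv_laguerreCoeff_succ {α : ℝ} (hα : -1 < α) (n : ℕ) :
    deriv (fun a => laguerreCoeff a (n + 1) n) α = (-1 : ℝ) ^ n / (Nat.factorial n) := by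
  have h : (fun a => laguerreCoeff a (n + 1) n) =ᶠ[nhds α]
      fun a => (n + a + 1) * ((-1 : ℝ) ^ n / (Nat.factorial n)) := by
    filter_upwards [Ioi_mem_nhds hα] with a ha
    have hpos := natCast_add_add_one_pos ha n
    have hΓ := (Real.Gamma_pos_of_pos hpos).ne'
    rw [laguerreCoeff, show ((n + 1 : ℕ) : ℝ) + a + 1 = n + a + 1 + 1 by push_cast; ring,
      Real.Gamma_add_one hpos.ne', Nat.add_sub_cancel_left, Nat.factorial_one, Nat.cast_one]
    field_simp
  have hd : HasDerivAt (fun a : ℝ => (n + a + 1) * ((-1 : ℝ) ^ n / (Nat.factorial n)))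
      (1 * ((-1 : ℝ) ^ n / (Nat.factorial n))) α :=
    (((hasDerivAt_id α).const_add (n : ℝ)).add_const 1).mul_const _
  rw [h.deriv_eq, hd.deriv, one_mul]

theorem deriv_laguerre {α : ℝ} (hα : -1 < α) (k : ℕ) (x : ℝ) :
    deriv (fun a => laguerre a k x) α =
      ∑ j ∈ Finset.range k, deriv (fun a => laguerreCoeff a k j) α * x ^ j := by
  have h := HasDerivAt.fun_sum fun j (_ : j ∈ Finset.range (k + 1)) =>
    (differentiableAt_laguerreCoeff hα k j).hasDerivAt.mul_const (x ^ j)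
  simp_rw [laguerre_eq_sum]
  rw [h.deriv, Finset.sum_range_succ, deriv_laguerreCoeff_self hα, zero_mul, add_zero]

/-- For `k ≥ 1` and `α > −1`,
`∫_0^∞ x^{α+1} L_k^{(α)}(x) (∂/∂α)L_k^{(α)}(x) e^{−x} dx = −Γ(k+α+1)/(k−1)!`,
the derivative of the Laguerre polynomial in the parameter `α` being taken
coefficientwise (i.e. as the derivative of `a ↦ L_k^{(a)}(x)`). -/
theorem laguerre_param_deriv_integral (k : ℕ) (hk : 1 ≤ k) (α : ℝ) (hα : -1 < α) :
    ∫ x in Set.Ioi (0 : ℝ),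
        x ^ (α + 1) * laguerre α k x * deriv (fun a : ℝ => laguerre a k x) α *
          Real.exp (-x) =
      -(Real.Gamma (k + α + 1) / (Nat.factorial (k - 1))) := by
  obtain ⟨n, rfl⟩ := Nat.exists_eq_add_of_le' hk
  have hsum : ∀ x ∈ Set.Ioi (0 : ℝ),
      x ^ (α + 1) * laguerre α (n + 1) x * deriv (fun a : ℝ => laguerre a (n + 1) x) α *
          Real.exp (-x) =
        ∑ j ∈ Finset.range (n + 1), deriv (fun a => laguerreCoeff a (n + 1) j) α *
          (x ^ (α + (j + 1 : ℕ)) * laguerre α (n + 1) x * Real.exp (-x)) := by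
    intro x hx
    rw [deriv_laguerre hα, Finset.mul_sum, Finset.sum_mul]
    refine Finset.sum_congr rfl fun j _ => ?_
    rw [show α + (j + 1 : ℕ) = α + 1 + j by push_cast; ring,
      Real.rpow_add_natCast (ne_of_gt hx) (α + 1) j]
    ring
  rw [setIntegral_congr_fun measurableSet_Ioi hsum, integral_finsetSum _ fun j _ =>
    (integrableOn_rpow_mul_laguerre_mul_exp hα (n + 1) (j + 1)).const_mul _]
  simp_rw [integral_const_mul]
  rw [Finset.sum_range_succ, Finset.sum_eq_zero fun j hj => ?_,
    integral_rpow_mul_laguerre_mul_exp_self hα, deriv_laguerreCoeff_succ hα, zero_add,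
    Nat.add_sub_cancel, pow_succ]
  · have h : (-1 : ℝ) ^ n * (-1) ^ n = 1 := by rw [← mul_pow]; simp
    linear_combination
      (-Real.Gamma ((n + 1 : ℕ) + α + 1) / (Nat.factorial n)) * h
  · rw [integral_rpow_mul_laguerre_mul_exp_of_lt hα
      (Nat.succ_lt_succ (Finset.mem_range.mp hj)), mul_zero]
end
end
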